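/- Let s and l be positive integers and let m be a positive integer with 2 ≤ m ≤ s·l. Then ∑ C(l,k_1)·C(l,k_2)···C(l,k_s)·(k_1 + 2k_2 + ⋯ + s·k_s)² = ( m(s+1)(3s²lm + 3slm + s²l − 4sm − sl − 2m) / (12(sl − 1)) ) · C(sl, m), where the sum ranges over all s-tuples (k_1, …, k_s) of nonnegative integers with k_i ≤ l for each i and ∑_{i=1}^s k_i = m. -/

import Mathlib

open Polynomial in
/-- Extracting a coefficient from a finite product of polynomials, each given as a finite sum of
monomials. -/
lemma sum_filter_piFinset_prod_eq_coeff {ι R : Type*} [Fintype ι] [DecidableEq ι] [CommSemiring R]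
    (r : Finset ℕ) (c : ι → ℕ → R) (m : ℕ) :
    ∑ k ∈ Finset.filter (fun k : ι → ℕ => ∑ i, k i = m) (Fintype.piFinset fun _ => r),
      ∏ i, c i (k i) = (∏ i, ∑ j ∈ r, C (c i j) * X ^ j).coeff m := by
  rw [Finset.prod_univ_sum, finsetSum_coeff, Finset.sum_filter]
  refine Finset.sum_congr rfl fun k _ => ?_
  rw [Finset.prod_mul_distrib, Finset.prod_pow_eq_pow_sum, ← map_prod, coeff_C_mul, coeff_X_pow]
  simp [eq_comm]

open Polynomial in
/-- The polynomial `∑ j, C(l, j) j ^ e X ^ j`. -/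
noncomputable def chooseMomentPoly (l e : ℕ) : ℚ[X] :=
  ∑ j ∈ Finset.range (l + 1), C ((l.choose j : ℚ) * (j : ℚ) ^ e) * X ^ j

open Polynomial in
lemma chooseMomentPoly_zero (l : ℕ) : chooseMomentPoly l 0 = (1 + X) ^ l := by
  rw [chooseMomentPoly, add_comm (1 : ℚ[X]), add_pow]
  refine Finset.sum_congr rfl fun j _ => ?_
  simp [mul_comm]

open Polynomial in
lemma chooseMomentPoly_succ (l e : ℕ) :
    chooseMomentPoly l (e + 1) = X * derivative (chooseMomentPoly l e) := by
  rw [chooseMomentPoly, chooseMomentPoly, derivative_sum, Finset.mul_sum]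
  refine Finset.sum_congr rfl fun j _ => ?_
  cases j with
  | zero => simp
  | succ j =>
    rw [derivative_C_mul_X_pow]
    simp only [map_mul, map_pow, map_natCast, Nat.add_sub_cancel]
    ring

open Polynomial in
lemma one_add_X_mul_derivative_pow (l : ℕ) :
    (1 + X) * derivative ((1 + X : ℚ[X]) ^ l) = (l : ℚ[X]) * (1 + X) ^ l := by
  cases l with
  | zero => simp
  | succ l =>
    rw [derivative_pow]
    simp only [map_add, derivative_one, derivative_X, Nat.add_sub_cancel, map_natCast]
    ring

open Polynomial in
lemma chooseMomentPoly_one_mul (l : ℕ) :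
    chooseMomentPoly l 1 * (1 + X) = (l : ℚ[X]) * X * (1 + X) ^ l := by
  rw [chooseMomentPoly_succ, chooseMomentPoly_zero]
  linear_combination X * one_add_X_mul_derivative_pow l

open Polynomial in
lemma chooseMomentPoly_two_mul (l : ℕ) :
    chooseMomentPoly l 2 * (1 + X) ^ 2 =
      ((l : ℚ[X]) * X + (l : ℚ[X]) ^ 2 * X ^ 2) * (1 + X) ^ l := by
  have h := congrArg derivative (chooseMomentPoly_one_mul l)
  simp only [derivative_mul, map_add, derivative_one, derivative_X, derivative_natCast] at h
  rw [chooseMomentPoly_succ l 1]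
  linear_combination X * (1 + X) * h - X * chooseMomentPoly_one_mul l +
    (l : ℚ[X]) * X ^ 2 * one_add_X_mul_derivative_pow l

open Polynomial in
lemma prod_chooseMomentPoly {ι : Type*} [Fintype ι] [DecidableEq ι] (l : ℕ)
    (hn : 2 ≤ Fintype.card ι * l) (i j : ι) :
    ∏ t, chooseMomentPoly l ((if t = i then 1 else 0) + if t = j then 1 else 0) =
      (if i = j then (l : ℚ[X]) * X else 0) * (1 + X) ^ (Fintype.card ι * l - 2) +
        (l : ℚ[X]) ^ 2 * X ^ 2 * (1 + X) ^ (Fintype.card ι * l - 2) := by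
  have hX : (1 + X : ℚ[X]) ≠ 0 := by
    rw [add_comm]; exact (monic_X_add_C (1 : ℚ)).ne_zero
  refine mul_right_cancel₀ (pow_ne_zero 2 hX) ?_
  have hpow : (1 + X : ℚ[X]) ^ (Fintype.card ι * l - 2) * (1 + X) ^ 2 =
      ∏ _t : ι, (1 + X) ^ l := by
    rw [← pow_add, Nat.sub_add_cancel hn, Finset.prod_const, ← pow_mul, Finset.card_univ, mul_comm]
  have htwo : (1 + X : ℚ[X]) ^ 2 =
      ∏ t : ι, (1 + X) ^ ((if t = i then 1 else 0) + if t = j then 1 else 0) := by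
    rw [Finset.prod_pow_eq_pow_sum]
    simp [Finset.sum_add_distrib]
  rw [← add_mul, mul_assoc, hpow, htwo, ← Finset.prod_mul_distrib]
  by_cases hij : i = j
  · subst hij
    have hR : (l : ℚ[X]) * X + (l : ℚ[X]) ^ 2 * X ^ 2 =
        ∏ t : ι, if t = i then (l : ℚ[X]) * X + (l : ℚ[X]) ^ 2 * X ^ 2 else 1 := by simp
    rw [if_pos rfl, hR, ← Finset.prod_mul_distrib]
    refine Finset.prod_congr rfl fun t _ => ?_
    by_cases ht : t = i
    · simpa [ht] using chooseMomentPoly_two_mul l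
    · simp [ht, chooseMomentPoly_zero]
  · have hR : 0 + (l : ℚ[X]) ^ 2 * X ^ 2 =
        ∏ t : ι, ((if t = i then (l : ℚ[X]) * X else 1) * if t = j then (l : ℚ[X]) * X else 1) := by
      rw [Finset.prod_mul_distrib]
      simp only [Finset.prod_ite_eq', Finset.mem_univ, if_true]
      ring
    rw [if_neg hij, hR, ← Finset.prod_mul_distrib]
    refine Finset.prod_congr rfl fun t _ => ?_
    by_cases ht : t = i
    · subst ht
      simpa [hij] using chooseMomentPoly_one_mul l
    · by_cases ht' : t = j
      · simpa [ht, ht', Ne.symm hij] using chooseMomentPoly_one_mul l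
      · simp [ht, ht', chooseMomentPoly_zero]

open Polynomial in
/-- The mixed second moments of the products of binomial coefficients. -/
lemma sum_prod_choose_mul_mul {ι : Type*} [Fintype ι] [DecidableEq ι] (l m : ℕ)
    (hn : 2 ≤ Fintype.card ι * l) (i j : ι) :
    ∑ k ∈ Finset.filter (fun k : ι → ℕ => ∑ i, k i = m + 2)
        (Fintype.piFinset fun _ => Finset.range (l + 1)),
      (∏ t, (l.choose (k t) : ℚ)) * ((k i : ℚ) * (k j : ℚ)) =
      (if i = j then (l : ℚ) * ((Fintype.card ι * l - 2).choose (m + 1) : ℚ) else 0) +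
        (l : ℚ) ^ 2 * ((Fintype.card ι * l - 2).choose m : ℚ) := by
  have h := sum_filter_piFinset_prod_eq_coeff (Finset.range (l + 1))
    (fun t a => (l.choose a : ℚ) *
      (a : ℚ) ^ ((if t = i then 1 else 0) + if t = j then 1 else 0)) (m + 2)
  have hp := prod_chooseMomentPoly l hn i j
  simp only [chooseMomentPoly] at hp
  rw [hp] at h
  convert h using 1
  · refine Finset.sum_congr rfl fun k _ => ?_
    simp only [Finset.prod_mul_distrib, pow_add]
    simp
  · rw [← C_eq_natCast, ← C_pow, coeff_add, mul_assoc (C _) (X ^ 2), coeff_C_mul,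
      coeff_X_pow_mul, coeff_one_add_X_pow]
    congr 1
    split_ifs
    · rw [mul_assoc, coeff_C_mul, coeff_X_mul, coeff_one_add_X_pow]
    · simp

/-- The second moment of a weighted sum, for arbitrary weights. -/
lemma sum_prod_choose_mul_sq {ι : Type*} [Fintype ι] [DecidableEq ι] (l m : ℕ)
    (hn : 2 ≤ Fintype.card ι * l) (w : ι → ℚ) :
    ∑ k ∈ Finset.filter (fun k : ι → ℕ => ∑ i, k i = m + 2)
        (Fintype.piFinset fun _ => Finset.range (l + 1)),
      (∏ t, (l.choose (k t) : ℚ)) * (∑ i, w i * (k i : ℚ)) ^ 2 =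
      (∑ i, w i ^ 2) * (l * ((Fintype.card ι * l - 2).choose (m + 1) : ℚ)) +
        (∑ i, w i) ^ 2 * (l ^ 2 * ((Fintype.card ι * l - 2).choose m : ℚ)) := by
  calc
    _ = ∑ i, ∑ j, w i * w j * ∑ k ∈ Finset.filter (fun k : ι → ℕ => ∑ i, k i = m + 2)
        (Fintype.piFinset fun _ => Finset.range (l + 1)),
          (∏ t, (l.choose (k t) : ℚ)) * ((k i : ℚ) * (k j : ℚ)) := by
      simp_rw [sq, Finset.sum_mul_sum, Finset.mul_sum]
      rw [Finset.sum_comm]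
      refine Finset.sum_congr rfl fun i _ => ?_
      rw [Finset.sum_comm]
      refine Finset.sum_congr rfl fun j _ => Finset.sum_congr rfl fun k _ => ?_
      ring
    _ = _ := by
      simp_rw [sum_prod_choose_mul_mul l m hn, mul_add, Finset.sum_add_distrib]
      congr 1
      · simp [Finset.sum_mul, sq]
      · rw [sq (∑ i, w i), Finset.sum_mul_sum]
        simp_rw [Finset.sum_mul]

lemma sum_fin_val_add_one (s : ℕ) : ∑ i : Fin s, ((i.val : ℚ) + 1) = (s : ℚ) * (s + 1) / 2 := by
  induction s with
  | zero => simp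
  | succ s ih =>
    rw [Fin.sum_univ_castSucc]
    simp only [Fin.val_castSucc, Fin.val_last, ih]
    push_cast
    ring

lemma sum_fin_val_add_one_sq (s : ℕ) :
    ∑ i : Fin s, ((i.val : ℚ) + 1) ^ 2 =
      (s : ℚ) * (s + 1) * (2 * s + 1) / 6 := by
  induction s with
  | zero => simp
  | succ s ih =>
    rw [Fin.sum_univ_castSucc]
    simp only [Fin.val_castSucc, Fin.val_last, ih]
    push_cast
    ring

theorem stmt_15 (s l : ℕ) (hs : 1 ≤ s) (hl : 1 ≤ l)
    (m : ℕ) (hm : 2 ≤ m) (hmn : m ≤ s * l) :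
    ∑ k ∈ Finset.filter (fun k : Fin s → ℕ => ∑ i, k i = m)
        (Fintype.piFinset fun _ => Finset.range (l + 1)),
      ((∏ i, (l.choose (k i) : ℚ)) * (∑ i, ((i.val : ℚ) + 1) * (k i : ℚ)) ^ 2)
      = ((m : ℚ) * ((s : ℚ) + 1) *
            (3 * (s : ℚ) ^ 2 * (l : ℚ) * (m : ℚ) + 3 * (s : ℚ) * (l : ℚ) * (m : ℚ)
              + (s : ℚ) ^ 2 * (l : ℚ) - 4 * (s : ℚ) * (m : ℚ) - (s : ℚ) * (l : ℚ) - 2 * (m : ℚ))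
            / (12 * ((s : ℚ) * (l : ℚ) - 1))) * ((s * l).choose m : ℚ) := by
  obtain ⟨m, rfl⟩ := Nat.exists_eq_add_of_le' hm
  have hn : 2 ≤ s * l := hm.trans hmn
  rw [sum_prod_choose_mul_sq l m (by simpa using hn), sum_fin_val_add_one, sum_fin_val_add_one_sq,
    Fintype.card_fin]
  obtain ⟨n, hsl⟩ := Nat.exists_eq_add_of_le' hn
  rw [hsl, Nat.add_sub_cancel]
  have hslq : (s : ℚ) * l = n + 2 := by exact_mod_cast hsl
  have h1 : ((n : ℚ) + 2) * ((n + 1).choose (m + 1)) = (n + 2).choose (m + 2) * (m + 2) := by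
    exact_mod_cast Nat.add_one_mul_choose_eq (n + 1) (m + 1)
  have h2 : ((n : ℚ) + 1) * (n.choose m) = (n + 1).choose (m + 1) * (m + 1) := by
    exact_mod_cast Nat.add_one_mul_choose_eq n m
  have h3 : ((n + 1).choose (m + 1) : ℚ) = n.choose m + n.choose (m + 1) := by
    exact_mod_cast Nat.choose_succ_succ n m
  have hn1 : (n : ℚ) + 1 ≠ 0 := by positivity
  have hn2 : (n : ℚ) + 2 ≠ 0 := by positivity
  have hs0 : (s : ℚ) ≠ 0 := by positivity
  have hl' : (l : ℚ) = (n + 2) / s := by field_simp; linarith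
  have e1 : ((n + 1).choose (m + 1) : ℚ) = (n + 2).choose (m + 2) * (m + 2) / (n + 2) := by
    field_simp; linarith
  have e2 : (n.choose m : ℚ) = (n + 2).choose (m + 2) * (m + 2) / (n + 2) * (m + 1) / (n + 1) := by
    rw [← e1]; field_simp; linarith
  have e3 : (n.choose (m + 1) : ℚ) = (n + 2).choose (m + 2) * (m + 2) / (n + 2) -
      (n + 2).choose (m + 2) * (m + 2) / (n + 2) * (m + 1) / (n + 1) := by
    linear_combination e1 - e2 - h3
  have hd : (s : ℚ) * l - 1 = n + 1 := by rw [hslq]; ring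
  rw [hd, e2, e3, hl']
  push_cast
  field_simp
  ring
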